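/- Every Q ∈ 𝔾_{L,q} satisfies d(ℛ·Q) ≤ (1 − 𝜼·(1 − ‖(γ̂^⊥)*Qγ̂^⊥‖))·d(Q), where 𝜼 := η(L_c, L_b+L_c). -/

import Mathlib

open Matrix BigOperators

noncomputable section

/-- The `ℓ² → ℓ²` operator norm of a rectangular complex matrix. -/
def opNorm {m n : ℕ} (A : Matrix (Fin m) (Fin n) ℂ) : ℝ :=
  ‖LinearMap.toContinuousLinearMap (Matrix.toEuclideanLin A)‖

/-- Membership in the Grassmannian `𝔾_{L,q}`: an orthogonal projection of rank `q`. -/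
def IsProjOfRank {L : ℕ} (q : ℕ) (Q : Matrix (Fin L) (Fin L) ℂ) : Prop :=
  Q * Q = Q ∧ Qᴴ = Q ∧ Q.trace = (q : ℂ)

/-- The action `T · Q` of an invertible matrix `T` on the Grassmannian: for `Q = ΦΦ*` this
equals `TΦ(Φ*T*TΦ)⁻¹Φ*T*`, i.e. the orthogonal projection onto `T (ran Q)`. -/
def grAct {L : ℕ} (T Q : Matrix (Fin L) (Fin L) ℂ) : Matrix (Fin L) (Fin L) ℂ :=
  T * Q * (Q * Tᴴ * T * Q + (1 - Q))⁻¹ * (Q * Tᴴ)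

/-- Relative gap `η(I,J) = 1 - κ_J²/κ_I²` (1-based indices). -/
def eta (κ : ℕ → ℝ) (i j : ℕ) : ℝ := 1 - κ j ^ 2 / κ i ^ 2

/-- The diagonal matrix `ℛ = diag(κ_L, …, κ_1)` (top-to-bottom entries `κ_L, …, κ_1`). -/
def Rmat (κ : ℕ → ℝ) (L : ℕ) : Matrix (Fin L) (Fin L) ℂ :=
  Matrix.diagonal fun i : Fin L => (κ (L - (i : ℕ)) : ℂ)

/-- The frame consisting of the standard basis vectors `e_{s+1}, …, e_{s+r}`
(rows `s, …, s+r-1`). -/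
def basisFrame (L r s : ℕ) : Matrix (Fin L) (Fin r) ℂ :=
  Matrix.of fun i j => if (i : ℕ) = s + (j : ℕ) then 1 else 0

/-- `d(Q) = tr(α̂* Q α̂)`, the (real) trace of the upper-left `L_a × L_a` block of `Q`. -/
def dProj (La : ℕ) {L : ℕ} (Q : Matrix (Fin L) (Fin L) ℂ) : ℝ :=
  (∑ i : Fin L, if (i : ℕ) < La then Q i i else 0).re

section helpers

variable {L : ℕ}

/-- Real diagonal matrix, as a complex matrix. -/
def rdiag (r : Fin L → ℝ) : Matrix (Fin L) (Fin L) ℂ := Matrix.diagonal fun i => (r i : ℂ)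

lemma rdiag_conj (r : Fin L → ℝ) : (rdiag r)ᴴ = rdiag r := by
  simp only [rdiag, Matrix.diagonal_conjTranspose]
  congr 1
  ext i
  simp

lemma rdiag_mul (r s : Fin L → ℝ) : rdiag r * rdiag s = rdiag (fun i => r i * s i) := by
  simp [rdiag, Matrix.diagonal_mul_diagonal]

lemma cm_diag (M : Matrix (Fin L) (Fin L) ℂ) (i : Fin L) :
    ((Mᴴ * M) i i).re = ∑ j, ‖M j i‖ ^ 2 := by
  rw [Matrix.mul_apply, Complex.re_sum]
  refine Finset.sum_congr rfl fun j _ => ?_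
  rw [Matrix.conjTranspose_apply, ← Complex.normSq_eq_norm_sq, Complex.normSq_apply]
  simp

lemma proj_diag {P : Matrix (Fin L) (Fin L) ℂ} (h1 : P * P = P) (h2 : Pᴴ = P) (i : Fin L) :
    (P i i).re = ∑ j, ‖P j i‖ ^ 2 := by
  rw [← cm_diag, h2, h1]

/-- Contraction property of an orthogonal projection. -/
lemma proj_contr {P : Matrix (Fin L) (Fin L) ℂ} (h1 : P * P = P) (h2 : Pᴴ = P)
    (K : Matrix (Fin L) (Fin L) ℂ) (i : Fin L) :
    ∑ j, ‖(P * K) j i‖ ^ 2 ≤ ∑ j, ‖K j i‖ ^ 2 := by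
  rw [← cm_diag, ← cm_diag]
  have e : Kᴴ * K = (P * K)ᴴ * (P * K) + (K - P * K)ᴴ * (K - P * K) := by
    simp only [Matrix.conjTranspose_mul, Matrix.conjTranspose_sub, h2]
    have : Kᴴ * P * (P * K) = Kᴴ * (P * K) := by
      rw [Matrix.mul_assoc, ← Matrix.mul_assoc P P, h1]
    rw [Matrix.sub_mul, Matrix.mul_sub, Matrix.mul_sub, this, Matrix.mul_assoc Kᴴ P K]
    abel
  rw [e, Matrix.add_apply, Complex.add_re, cm_diag (K - P * K)]
  have : 0 ≤ ∑ j, ‖(K - P * K) j i‖ ^ 2 := Finset.sum_nonneg fun j _ => by positivity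
  linarith

open scoped ComplexOrder in
lemma gr_isUnit {Q : Matrix (Fin L) (Fin L) ℂ} (h1 : Q * Q = Q) (h2 : Qᴴ = Q)
    {r : Fin L → ℝ} (hr : ∀ i, 0 < r i) :
    IsUnit (Q * (rdiag r)ᴴ * rdiag r * Q + (1 - Q)).det := by
  rw [isUnit_iff_ne_zero]
  intro h0
  obtain ⟨v, hv, hv0⟩ := Matrix.exists_mulVec_eq_zero_iff.mpr h0
  apply hv
  have hA : Q * (Q * (rdiag r)ᴴ * rdiag r * Q + (1 - Q)) = (rdiag r * Q)ᴴ * (rdiag r * Q) := by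
    rw [Matrix.mul_add, Matrix.mul_sub, h1, Matrix.mul_one, sub_self, add_zero,
      Matrix.conjTranspose_mul, h2]
    simp only [← Matrix.mul_assoc, h1]
  have hB : (1 - Q) * (Q * (rdiag r)ᴴ * rdiag r * Q + (1 - Q)) = 1 - Q := by
    have : (1 - Q) * Q = 0 := by rw [Matrix.sub_mul, h1, Matrix.one_mul, sub_self]
    rw [Matrix.mul_add]
    simp only [← Matrix.mul_assoc, this, Matrix.zero_mul, zero_add]
    rw [Matrix.mul_sub, this, Matrix.mul_one, sub_zero]
  have e1 : (rdiag r * Q) *ᵥ v = 0 := by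
    rw [← Matrix.conjTranspose_mul_self_mulVec_eq_zero, ← hA, ← Matrix.mulVec_mulVec, hv0,
      Matrix.mulVec_zero]
  have e2 : (1 - Q) *ᵥ v = 0 := by
    rw [← hB, ← Matrix.mulVec_mulVec, hv0, Matrix.mulVec_zero]
  have e3 : Q *ᵥ v = v := by
    rw [Matrix.sub_mulVec, Matrix.one_mulVec, sub_eq_zero] at e2
    exact e2.symm
  rw [← Matrix.mulVec_mulVec, e3] at e1
  ext i
  have := congrFun e1 i
  simpa [rdiag, Matrix.mulVec_diagonal, (hr i).ne'] using this

lemma gr_props {Q : Matrix (Fin L) (Fin L) ℂ} (h1 : Q * Q = Q) (h2 : Qᴴ = Q)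
    {r : Fin L → ℝ} (hr : ∀ i, 0 < r i) :
    (grAct (rdiag r) Q)ᴴ = grAct (rdiag r) Q ∧
    grAct (rdiag r) Q * (rdiag r * Q) = rdiag r * Q ∧
    grAct (rdiag r) Q * grAct (rdiag r) Q = grAct (rdiag r) Q ∧
    (∃ Z, grAct (rdiag r) Q = rdiag r * Q * Z) ∧
    (∃ W, grAct (rdiag r) Q = W * (Q * rdiag r)) ∧
    (grAct (rdiag r) Q).trace = Q.trace := by
  have hu := gr_isUnit h1 h2 hr
  unfold grAct
  set G := Q * (rdiag r)ᴴ * rdiag r * Q + (1 - Q) with hG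
  have hQQ : Q * (1 - Q) = 0 := by rw [Matrix.mul_sub, h1, Matrix.mul_one, sub_self]
  have hGq : G * (1 - Q) = 1 - Q := by
    rw [hG, Matrix.add_mul, Matrix.mul_assoc _ Q, hQQ, Matrix.mul_zero, zero_add, Matrix.sub_mul,
      hQQ, Matrix.one_mul, sub_zero]
  have hGi : G⁻¹ * (1 - Q) = 1 - Q := by
    conv_lhs => rw [← hGq]
    rw [← Matrix.mul_assoc, Matrix.nonsing_inv_mul _ hu, Matrix.one_mul]
  have hGh : Gᴴ = G := by
    rw [hG]
    simp [Matrix.conjTranspose_mul, h2, Matrix.mul_assoc]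
  have hGih : (G⁻¹)ᴴ = G⁻¹ := by rw [Matrix.conjTranspose_nonsing_inv, hGh]
  have hGG : G⁻¹ * (Q * (rdiag r)ᴴ * (rdiag r * Q)) = Q := by
    have : Q * (rdiag r)ᴴ * (rdiag r * Q) = G - (1 - Q) := by
      rw [hG, add_sub_cancel_right]; simp only [Matrix.mul_assoc]
    rw [this, Matrix.mul_sub, hGi, Matrix.nonsing_inv_mul _ hu, sub_sub_cancel]
  have hPR : rdiag r * Q * G⁻¹ * (Q * (rdiag r)ᴴ) * (rdiag r * Q) = rdiag r * Q := by
    rw [Matrix.mul_assoc _ (Q * (rdiag r)ᴴ), Matrix.mul_assoc _ G⁻¹, hGG, Matrix.mul_assoc, h1]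
  refine ⟨?_, hPR, ?_, ⟨G⁻¹ * (Q * (rdiag r)ᴴ), ?_⟩, ⟨rdiag r * Q * G⁻¹, ?_⟩, ?_⟩
  · simp [Matrix.conjTranspose_mul, h2, hGih, Matrix.mul_assoc]
  · rw [← Matrix.mul_assoc _ (rdiag r * Q * G⁻¹), ← Matrix.mul_assoc _ (rdiag r * Q), hPR]
  · simp only [Matrix.mul_assoc]
  · rw [rdiag_conj]
  · rw [Matrix.mul_assoc, Matrix.trace_mul_comm, Matrix.mul_assoc, hGG]

/-- Lowering the diagonal entries in the first block decreases the weight of that block. -/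
lemma stage1 {Q : Matrix (Fin L) (Fin L) ℂ} (h1 : Q * Q = Q) (h2 : Qᴴ = Q)
    {r s : Fin L → ℝ} (hr : ∀ i, 0 < r i) (hs : ∀ i, 0 < s i) (hrs : ∀ i, r i ≤ s i)
    (j : Fin L) (hj : r j = s j) :
    (grAct (rdiag s) Q j j).re ≤ (grAct (rdiag r) Q j j).re := by
  obtain ⟨p1, p2, p3, -, -, -⟩ := gr_props h1 h2 hr
  obtain ⟨q1, q2, q3, ⟨Z, hZ⟩, -, -⟩ := gr_props h1 h2 hs
  set P := grAct (rdiag r) Q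
  set P' := grAct (rdiag s) Q
  set D : Matrix (Fin L) (Fin L) ℂ := rdiag (fun i => r i / s i) with hD
  have hDs : D * rdiag s = rdiag r := by
    rw [hD, rdiag_mul]
    congr 1
    ext i
    exact div_mul_cancel₀ _ (hs i).ne'
  have hPD : P * (D * P') = D * P' := by
    rw [hZ, ← Matrix.mul_assoc D, ← Matrix.mul_assoc D, hDs, ← Matrix.mul_assoc P, p2]
  have hjj : (D * P') j j = P' j j := by
    simp [hD, rdiag, Matrix.diagonal_mul, hj, (hs j).ne']
  have hc := Finset.sum_nonneg (s := Finset.univ) (f := fun k => ‖(D * P' - P) k j‖ ^ 2)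
    (fun k _ => by positivity)
  rw [← cm_diag] at hc
  have hx : P * (D * P') = D * P' := hPD
  have hy : (D * P')ᴴ * P = (D * P')ᴴ := by
    conv_rhs => rw [← hPD]
    rw [Matrix.conjTranspose_mul P, p1]
  have hex : (D * P' - P)ᴴ * (D * P' - P)
      = (D * P')ᴴ * (D * P') - (D * P')ᴴ - D * P' + P := by
    rw [Matrix.conjTranspose_sub, Matrix.sub_mul, Matrix.mul_sub, Matrix.mul_sub, hy, p1, hx, p3]
    abel
  rw [hex] at hc
  simp only [Matrix.add_apply, Matrix.sub_apply, Complex.add_re, Complex.sub_re,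
    Matrix.conjTranspose_apply, hjj] at hc
  rw [cm_diag] at hc
  have hle : ∑ k, ‖(D * P') k j‖ ^ 2 ≤ ∑ k, ‖P' k j‖ ^ 2 := by
    refine Finset.sum_le_sum fun k _ => ?_
    have hk : (D * P') k j = ((r k / s k : ℝ) : ℂ) * P' k j := by
      simp [hD, rdiag, Matrix.diagonal_mul]
    rw [hk, norm_mul, Complex.norm_real, Real.norm_of_nonneg (div_pos (hr k) (hs k)).le]
    have : r k / s k ≤ 1 := (div_le_one (hs k)).mpr (hrs k)
    have h0 := (div_pos (hr k) (hs k)).le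
    gcongr
    exact mul_le_of_le_one_left (norm_nonneg _) this
  rw [← proj_diag q3 q1] at hle
  have : (star (P' j j)).re = (P' j j).re := by simp
  linarith

lemma stage2 {Q : Matrix (Fin L) (Fin L) ℂ} (h1 : Q * Q = Q) (h2 : Qᴴ = Q)
    {s : Fin L → ℝ} (hs : ∀ i, 0 < s i) (i : Fin L) :
    (grAct (rdiag s) Q i i).re ≤ ∑ j, (s i / s j) ^ 2 * ‖Q j i‖ ^ 2 := by
  obtain ⟨q1, q2, q3, -, ⟨W, hW⟩, -⟩ := gr_props h1 h2 hs
  set P := grAct (rdiag s) Q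
  set S : Matrix (Fin L) (Fin L) ℂ := rdiag (fun j => s i / s j) with hS
  have hsS : rdiag s * S = (s i : ℂ) • 1 := by
    rw [hS, rdiag_mul]
    ext a b
    by_cases hab : a = b
    · subst hab
      have : s a * (s i / s a) = s i := mul_div_cancel₀ _ (hs a).ne'
      simp only [rdiag, Matrix.diagonal_apply_eq, this]
      simp
    · simp [rdiag, hab]
  have hPS : P * (S * Q) = P * S := by
    rw [hW]
    simp only [Matrix.mul_assoc]
    rw [← Matrix.mul_assoc (rdiag s) S, hsS]
    simp [h1]
  have hcol : ∀ k, (P * (S * Q)) k i = P k i := by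
    intro k
    rw [hPS]
    simp [hS, rdiag, Matrix.mul_diagonal, (hs i).ne']
  have h := proj_contr q3 q1 (S * Q) i
  simp only [hcol] at h
  rw [← proj_diag q3 q1] at h
  refine h.trans (le_of_eq (Finset.sum_congr rfl fun k _ => ?_))
  have hk : (S * Q) k i = ((s i / s k : ℝ) : ℂ) * Q k i := by
    simp [hS, rdiag, Matrix.diagonal_mul]
  rw [hk, norm_mul, Complex.norm_real, mul_pow, Real.norm_eq_abs, sq_abs]

lemma main_bound {Q : Matrix (Fin L) (Fin L) ℂ} (h1 : Q * Q = Q) (h2 : Qᴴ = Q)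
    {r : Fin L → ℝ} (hr : ∀ i, 0 < r i) (La : ℕ) (l : ℝ) (hl : 0 < l)
    (ha : ∀ i : Fin L, (i : ℕ) < La → r i ≤ l) (w : Fin L → ℝ)
    (hwa : ∀ i : Fin L, (i : ℕ) < La → 1 ≤ w i)
    (hwb : ∀ i : Fin L, ¬ (i : ℕ) < La → (l / r i) ^ 2 ≤ w i) :
    dProj La (grAct (rdiag r) Q) ≤
      ∑ i : Fin L, if (i : ℕ) < La then ∑ j, w j * ‖Q j i‖ ^ 2 else 0 := by
  set s : Fin L → ℝ := fun i => if (i : ℕ) < La then l else r i with hsdef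
  have hs : ∀ i, 0 < s i := by
    intro i; simp only [hsdef]; split_ifs
    · exact hl
    · exact hr i
  have hrs : ∀ i, r i ≤ s i := by
    intro i; simp only [hsdef]; split_ifs with h
    · exact ha i h
    · exact le_rfl
  have tr : (grAct (rdiag r) Q).trace = (grAct (rdiag s) Q).trace := by
    rw [(gr_props h1 h2 hr).2.2.2.2.2, (gr_props h1 h2 hs).2.2.2.2.2]
  have split : ∀ M : Matrix (Fin L) (Fin L) ℂ, dProj La M
      = M.trace.re - ∑ i : Fin L, if (i : ℕ) < La then 0 else (M i i).re := by
    intro M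
    rw [dProj, Matrix.trace, Complex.re_sum, Complex.re_sum, ← Finset.sum_sub_distrib]
    refine Finset.sum_congr rfl fun i _ => ?_
    split_ifs <;> simp
  have step : dProj La (grAct (rdiag r) Q) ≤ dProj La (grAct (rdiag s) Q) := by
    rw [split, split, tr]
    apply sub_le_sub_left
    refine Finset.sum_le_sum fun i _ => ?_
    split_ifs with h
    · exact le_rfl
    · exact stage1 h1 h2 hr hs hrs i (by simp [hsdef, h])
  refine step.trans ?_
  rw [dProj, Complex.re_sum]
  refine Finset.sum_le_sum fun i _ => ?_
  split_ifs with h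
  · refine (stage2 h1 h2 hs i).trans (Finset.sum_le_sum fun j _ => ?_)
    apply mul_le_mul_of_nonneg_right _ (by positivity)
    have hi : s i = l := by simp [hsdef, h]
    rw [hi]
    by_cases hj : (j : ℕ) < La
    · have : s j = l := by simp [hsdef, hj]
      rw [this, div_self hl.ne']
      simpa using hwa j hj
    · have : s j = r j := by simp [hsdef, hj]
      rw [this]
      exact hwb j hj
  · simp

open scoped Matrix.Norms.L2Operator

lemma opNorm_eq {m n : ℕ} (A : Matrix (Fin m) (Fin n) ℂ) : opNorm A = ‖A‖ := rfl

lemma frame_mul_apply (m : ℕ) (hm : m ≤ L) (M : Matrix (Fin L) (Fin L) ℂ) (a : Fin m) (b : Fin L) :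
    ((basisFrame L m 0)ᴴ * M) a b = M (Fin.castLE hm a) b := by
  rw [Matrix.mul_apply, Finset.sum_eq_single (Fin.castLE hm a)]
  · simp [basisFrame]
  · intro c _ hc
    have : (c : ℕ) ≠ a := fun h => hc (Fin.ext (by simpa using h))
    simp [basisFrame, this]
  · simp

lemma block_bound {Q : Matrix (Fin L) (Fin L) ℂ} (h1 : Q * Q = Q) (h2 : Qᴴ = Q)
    (m : ℕ) (hm : m ≤ L) (i : Fin L) :
    ∑ j : Fin L, (if (j : ℕ) < m then ‖Q j i‖ ^ 2 else 0)
      ≤ opNorm ((basisFrame L m 0)ᴴ * Q * basisFrame L m 0) * (Q i i).re := by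
  set g := basisFrame L m 0
  have e : gᴴ * Q * g = (Q * g)ᴴ * (Q * g) := by
    rw [Matrix.conjTranspose_mul, h2, Matrix.mul_assoc gᴴ Q (Q * g), ← Matrix.mul_assoc Q Q g, h1,
      Matrix.mul_assoc]
  rw [opNorm_eq, e, Matrix.l2_opNorm_conjTranspose_mul_self, ← Matrix.l2_opNorm_conjTranspose,
    Matrix.conjTranspose_mul, h2]
  have hv := Matrix.l2_opNorm_mulVec (gᴴ * Q) (WithLp.toLp 2 (fun j => Q j i))
  have hsq := pow_le_pow_left₀ (norm_nonneg _) hv 2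
  rw [mul_pow, EuclideanSpace.norm_sq_eq, EuclideanSpace.norm_sq_eq] at hsq
  rw [proj_diag h1 h2 i, ← sq]
  refine le_trans (le_of_eq ?_) hsq
  have hcol : ∀ a : Fin m, ((gᴴ * Q) *ᵥ (fun j => Q j i)) a = Q (Fin.castLE hm a) i := by
    intro a
    have : ((gᴴ * Q) *ᵥ (fun j => Q j i)) a = ((gᴴ * Q) * Q) a i := rfl
    rw [this, Matrix.mul_assoc, h1, frame_mul_apply m hm]
  obtain ⟨k, rfl⟩ := Nat.exists_eq_add_of_le hm
  rw [Fin.sum_univ_add]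
  simp
  exact Finset.sum_congr rfl fun x _ => by rw [hcol]; rfl

lemma opNorm_proj {Q : Matrix (Fin L) (Fin L) ℂ} (h1 : Q * Q = Q) (h2 : Qᴴ = Q) (hQ0 : Q ≠ 0) :
    opNorm Q = 1 := by
  rw [opNorm_eq]
  have := Matrix.l2_opNorm_conjTranspose_mul_self Q
  rw [h2, h1] at this
  exact (mul_eq_left₀ (norm_ne_zero_iff.mpr hQ0)).mp this.symm

end helpers

/-- contraction of `d` by the hyperbolic action:
`d(ℛ·Q) ≤ (1 − 𝜼·(1 − ‖(γ̂^⊥)*Qγ̂^⊥‖))·d(Q)` with `𝜼 = η(L_c, L_b+L_c)` and `γ̂^⊥` the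
frame of the first `L_a + L_b` standard basis vectors. -/
theorem statement5 (L La Lb Lc q : ℕ) (hL : L = La + Lb + Lc)
    (κ : ℕ → ℝ)
    (hκpos : ∀ i, 1 ≤ i → i ≤ L → 0 < κ i)
    (hκmono : ∀ i j, 1 ≤ i → i ≤ j → j ≤ L → κ j ≤ κ i)
    (Q : Matrix (Fin L) (Fin L) ℂ) (hQ : IsProjOfRank q Q) :
    dProj La (grAct (Rmat κ L) Q) ≤
      (1 - eta κ Lc (Lb + Lc)
          * (1 - opNorm ((basisFrame L (La + Lb) 0)ᴴ * Q * basisFrame L (La + Lb) 0)))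
        * dProj La Q := by
  obtain ⟨h1, h2, -⟩ := hQ
  rcases Nat.eq_zero_or_pos L with hL0 | hLpos
  · subst hL0
    simp [dProj]
  set r : Fin L → ℝ := fun i => κ (L - (i : ℕ)) with hrdef
  have hR : Rmat κ L = rdiag r := rfl
  have hr : ∀ i, 0 < r i := fun i => hκpos _ (by omega) (by omega)
  have hd : ∀ i, 0 ≤ (Q i i).re := fun i => by
    rw [proj_diag h1 h2 i]; exact Finset.sum_nonneg fun _ _ => by positivity
  rw [hR]
  rcases Nat.eq_zero_or_pos Lc with hc | hc
  · -- degenerate case: `γ̂^⊥` is the full basis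
    have key : dProj La (grAct (rdiag r) Q) ≤ dProj La Q := by
      obtain ⟨l, hl, hla, hlb⟩ : ∃ l : ℝ, 0 < l ∧ (∀ i : Fin L, (i : ℕ) < La → r i ≤ l) ∧
          (∀ i : Fin L, ¬ (i : ℕ) < La → l ≤ r i) := by
        rcases Nat.eq_zero_or_pos Lb with hb | hb
        · exact ⟨κ 1, hκpos 1 le_rfl hLpos,
            fun i _ => hκmono _ _ le_rfl (by omega) (by omega), fun i hi => by omega⟩
        · exact ⟨κ Lb, hκpos _ hb (by omega),
            fun i _ => hκmono _ _ hb (by omega) (by omega),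
            fun i hi => hκmono _ _ (by omega) (by omega) (by omega)⟩
      refine (main_bound h1 h2 hr La l hl hla (fun _ => 1) (fun _ _ => le_rfl) ?_).trans ?_
      · intro i hi
        have := hlb i hi
        have h' : l / r i ≤ 1 := (div_le_one (hr i)).mpr this
        exact pow_le_one₀ (div_pos hl (hr i)).le h'
      · rw [dProj, Complex.re_sum]
        refine Finset.sum_le_sum fun i _ => ?_
        split_ifs
        · simp [proj_diag h1 h2 i]
        · simp
    by_cases hQ0 : Q = 0
    · subst hQ0
      simp [dProj, grAct]
    · have hp : opNorm ((basisFrame L (La + Lb) 0)ᴴ * Q * basisFrame L (La + Lb) 0) = 1 := by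
        subst hc
        have hL' : L = La + Lb := hL
        clear hR key
        clear_value r
        subst hL'
        have hb : basisFrame (La + Lb) (La + Lb) 0 = 1 := by
          ext i j
          simp [basisFrame, Matrix.one_apply, Fin.ext_iff]
        rw [hb]
        simp only [Matrix.conjTranspose_one, Matrix.one_mul, Matrix.mul_one]
        exact opNorm_proj h1 h2 hQ0
      rw [hp]
      simpa using key
  · set η := eta κ Lc (Lb + Lc) with hη
    have hκc : 0 < κ Lc := hκpos _ hc (by omega)
    have hκb : 0 < κ (Lb + Lc) := hκpos _ (by omega) (by omega)
    have hη0 : 0 ≤ η := by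
      rw [hη, eta, sub_nonneg, div_le_one (by positivity)]
      exact pow_le_pow_left₀ hκb.le (hκmono _ _ hc (by omega) (by omega)) 2
    refine (main_bound h1 h2 hr La (κ (Lb + Lc)) hκb
      (fun i hi => hκmono _ _ (by omega) (by omega) (by omega))
      (fun j => if (j : ℕ) < La + Lb then 1 else 1 - η) ?_ ?_).trans ?_
    · intro i hi
      have : (i : ℕ) < La + Lb := by omega
      simp [this]
    · intro i hi
      have hri := hr i
      split_ifs with h
      · have : κ (Lb + Lc) ≤ r i := hκmono _ _ (by omega) (by omega) (by omega)
        exact pow_le_one₀ (div_pos hκb (hr i)).le ((div_le_one (hr i)).mpr this)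
      · have : κ Lc ≤ r i := hκmono _ _ (by omega) (by omega) (by omega)
        have e : 1 - η = (κ (Lb + Lc) / κ Lc) ^ 2 := by rw [hη, eta, div_pow]; ring
        rw [e]
        gcongr
    · rw [dProj, Complex.re_sum, Finset.mul_sum]
      refine Finset.sum_le_sum fun i _ => ?_
      split_ifs with h
      · have hb := block_bound h1 h2 (La + Lb) (by omega) i
        have e : ∑ j : Fin L, (if (j : ℕ) < La + Lb then 1 else 1 - η) * ‖Q j i‖ ^ 2
            = (1 - η) * ∑ j : Fin L, ‖Q j i‖ ^ 2
              + η * ∑ j : Fin L, (if (j : ℕ) < La + Lb then ‖Q j i‖ ^ 2 else 0) := by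
          rw [Finset.mul_sum, Finset.mul_sum, ← Finset.sum_add_distrib]
          refine Finset.sum_congr rfl fun j _ => ?_
          split_ifs <;> ring
        rw [e, ← proj_diag h1 h2 i]
        have := mul_le_mul_of_nonneg_left hb hη0
        linarith
      · simp

end
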